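/- arXiv:1312.1497 — 2 statements merged into one kernel-verified Lean document; each statement's English description precedes it below -/
import Mathlib

section
/- Let C and D be group-theoretical categories of partitions. Then C_sl = D_sl if and only if C = D. -/
open Classical

/-- A partition diagram with `upper` upper points and `lower` lower points; the blocks are
encoded by the equivalence relation (setoid) on the disjoint union of the points. -/
structure PartitionDiagram where
  upper : ℕ
  lower : ℕ
  rel : Setoid (Fin upper ⊕ Fin lower)

namespace PartitionDiagram

/-- The partition determined by a labelling of the points: two points lie in the same block
iff they receive the same label. -/
def ofLabels {u l : ℕ} (f : Fin u ⊕ Fin l → ℕ) : PartitionDiagram :=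
  ⟨u, l, Setoid.ker f⟩

/-- The identity partition `| ∈ P(1,1)`. -/
def idPartition : PartitionDiagram := ofLabels (u := 1) (l := 1) fun _ => 0

/-- The pair partition `⊓ ∈ P(0,2)`. -/
def pairPartition : PartitionDiagram := ofLabels (u := 0) (l := 2) fun _ => 0

/-- The four block partition `⊓⊓ ∈ P(0,4)`. -/
def fourBlock : PartitionDiagram := ofLabels (u := 0) (l := 4) fun _ => 0

/-- The singleton partition `↑ ∈ P(0,1)`. -/
def singletonPartition : PartitionDiagram := ofLabels (u := 0) (l := 1) fun _ => 0

/-- The double singleton partition `↑⊗↑ ∈ P(0,2)`. -/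
def doubleSingleton : PartitionDiagram :=
  ofLabels (u := 0) (l := 2) (Sum.elim (fun i => (i : ℕ)) fun j => (j : ℕ))

/-- The crossing partition `⨯ ∈ P(2,2)`, with blocks `{1,2'}` and `{2,1'}`. -/
def crossing : PartitionDiagram :=
  ofLabels (u := 2) (l := 2) (Sum.elim (fun i => (i : ℕ)) fun j => 1 - (j : ℕ))

/-- The pair positioner partition `▷ ∈ P(3,3)`, with blocks `{1,2,2',3'}` and `{3,1'}`. -/
def pairPositioner : PartitionDiagram :=
  ofLabels (u := 3) (l := 3)
    (Sum.elim (fun i => if (i : ℕ) = 2 then 1 else 0) fun j => if (j : ℕ) = 0 then 1 else 0)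

/-- The partition `k_l ∈ P(l+2, l+2)` consisting of the four block `{1, 1', l+2, (l+2)'}`
together with the pairs `{j, j'}` for `2 ≤ j ≤ l+1`. -/
def kPart (n : ℕ) : PartitionDiagram :=
  ofLabels (u := n + 2) (l := n + 2)
    (fun x => if (Sum.elim Fin.val Fin.val x) = 0 ∨ (Sum.elim Fin.val Fin.val x) = n + 1
      then 0 else Sum.elim Fin.val Fin.val x)

/-- The involution `p* ∈ P(l,k)` of `p ∈ P(k,l)`: turn the partition upside down. -/
def invol (p : PartitionDiagram) : PartitionDiagram :=
  ⟨p.lower, p.upper, Setoid.comap Sum.swap p.rel⟩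

/-- Auxiliary map splitting the points of a tensor product into the points of the two factors. -/
def splitPoint {a b c d : ℕ} (x : Fin (a + b) ⊕ Fin (c + d)) :
    (Fin a ⊕ Fin c) ⊕ (Fin b ⊕ Fin d) :=
  match x with
  | Sum.inl u =>
    match finSumFinEquiv.symm u with
    | Sum.inl i => Sum.inl (Sum.inl i)
    | Sum.inr i => Sum.inr (Sum.inl i)
  | Sum.inr v =>
    match finSumFinEquiv.symm v with
    | Sum.inl j => Sum.inl (Sum.inr j)
    | Sum.inr j => Sum.inr (Sum.inr j)

/-- The tensor product (horizontal concatenation) `p ⊗ q` of two partitions. -/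
def tensor (p q : PartitionDiagram) : PartitionDiagram :=
  ⟨p.upper + q.upper, p.lower + q.lower,
    Setoid.ker fun x =>
      Sum.map (Quotient.mk p.rel) (Quotient.mk q.rel) (splitPoint x)⟩

section Composition

variable (p q : PartitionDiagram) (h : p.lower = q.upper)

/-- Inclusion of the points of `p` into the three-row diagram used for composition. -/
def iotaP : Fin p.upper ⊕ Fin p.lower → Fin p.upper ⊕ (Fin p.lower ⊕ Fin q.lower) :=
  Sum.map id Sum.inl

/-- Inclusion of the points of `q` into the three-row diagram used for composition,
identifying the upper points of `q` with the lower points of `p`. -/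
def iotaQ : Fin q.upper ⊕ Fin q.lower → Fin p.upper ⊕ (Fin p.lower ⊕ Fin q.lower) :=
  fun x => Sum.inr (Sum.map (Fin.cast h.symm) id x)

/-- The generating relation on the three-row diagram used for composition. -/
def compRel : Fin p.upper ⊕ (Fin p.lower ⊕ Fin q.lower) →
    Fin p.upper ⊕ (Fin p.lower ⊕ Fin q.lower) → Prop :=
  fun x y =>
    (∃ a b, p.rel.r a b ∧ x = iotaP p q a ∧ y = iotaP p q b) ∨
    (∃ a b, q.rel.r a b ∧ x = iotaQ p q h a ∧ y = iotaQ p q h b)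

/-- The composition (vertical concatenation) `qp ∈ P(k,m)` of `p ∈ P(k,l)` and `q ∈ P(l,m)`:
identify the lower points of `p` with the upper points of `q`, take the join of the block
structures and restrict to the upper points of `p` and the lower points of `q`. -/
def comp : PartitionDiagram :=
  ⟨p.upper, q.lower,
    Setoid.comap (Sum.map id Sum.inr) (Relation.EqvGen.setoid (compRel p q h))⟩

end Composition

/-- Rotation of the leftmost upper point to the leftmost lower position. -/
def rotLU (p : PartitionDiagram) (h : 0 < p.upper) : PartitionDiagram :=
  ⟨p.upper - 1, p.lower + 1,
    Setoid.comap (fun x => match x with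
      | Sum.inl j => Sum.inl (⟨(j : ℕ) + 1, by have := j.isLt; omega⟩ : Fin p.upper)
      | Sum.inr j => if hj : (j : ℕ) = 0 then Sum.inl (⟨0, h⟩ : Fin p.upper)
          else Sum.inr (⟨(j : ℕ) - 1, by have := j.isLt; omega⟩ : Fin p.lower)) p.rel⟩

/-- Rotation of the leftmost lower point to the leftmost upper position. -/
def rotLD (p : PartitionDiagram) (h : 0 < p.lower) : PartitionDiagram :=
  ⟨p.upper + 1, p.lower - 1,
    Setoid.comap (fun x => match x with
      | Sum.inl j => if hj : (j : ℕ) = 0 then Sum.inr (⟨0, h⟩ : Fin p.lower)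
          else Sum.inl (⟨(j : ℕ) - 1, by have := j.isLt; omega⟩ : Fin p.upper)
      | Sum.inr j => Sum.inr (⟨(j : ℕ) + 1, by have := j.isLt; omega⟩ : Fin p.lower)) p.rel⟩

/-- Rotation of the rightmost upper point to the rightmost lower position. -/
def rotRU (p : PartitionDiagram) (h : 0 < p.upper) : PartitionDiagram :=
  ⟨p.upper - 1, p.lower + 1,
    Setoid.comap (fun x => match x with
      | Sum.inl j => Sum.inl (⟨(j : ℕ), by have := j.isLt; omega⟩ : Fin p.upper)
      | Sum.inr j => if hj : (j : ℕ) < p.lower then Sum.inr (⟨(j : ℕ), hj⟩ : Fin p.lower)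
          else Sum.inl (⟨p.upper - 1, by omega⟩ : Fin p.upper)) p.rel⟩

/-- Rotation of the rightmost lower point to the rightmost upper position. -/
def rotRD (p : PartitionDiagram) (h : 0 < p.lower) : PartitionDiagram :=
  ⟨p.upper + 1, p.lower - 1,
    Setoid.comap (fun x => match x with
      | Sum.inl j => if hj : (j : ℕ) < p.upper then Sum.inl (⟨(j : ℕ), hj⟩ : Fin p.upper)
          else Sum.inr (⟨p.lower - 1, by omega⟩ : Fin p.lower)
      | Sum.inr j => Sum.inr (⟨(j : ℕ), by have := j.isLt; omega⟩ : Fin p.lower)) p.rel⟩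

/-- The partition obtained from `p` by merging the block of the point `a` and the block of
the point `b` into a single block, leaving all other blocks unchanged. -/
noncomputable def mergeBlocks (p : PartitionDiagram)
    (a b : Fin p.upper ⊕ Fin p.lower) : PartitionDiagram :=
  ⟨p.upper, p.lower,
    Setoid.ker fun x =>
      if p.rel.r x a ∨ p.rel.r x b then (none : Option (Quotient p.rel))
      else some (Quotient.mk p.rel x)⟩

end PartitionDiagram

open PartitionDiagram

/-- A set of partitions is a category of partitions if it contains the identity partition and
the pair partition and is closed under tensor products, composition, involution and the four
rotation operations. -/
structure IsPartitionCategory (M : Set PartitionDiagram) : Prop where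
  id_mem : idPartition ∈ M
  pair_mem : pairPartition ∈ M
  tensor_mem : ∀ p ∈ M, ∀ q ∈ M, tensor p q ∈ M
  comp_mem : ∀ p ∈ M, ∀ q ∈ M, ∀ h : p.lower = q.upper, comp p q h ∈ M
  invol_mem : ∀ p ∈ M, invol p ∈ M
  rotLU_mem : ∀ p ∈ M, ∀ h : 0 < p.upper, rotLU p h ∈ M
  rotLD_mem : ∀ p ∈ M, ∀ h : 0 < p.lower, rotLD p h ∈ M
  rotRU_mem : ∀ p ∈ M, ∀ h : 0 < p.upper, rotRU p h ∈ M
  rotRD_mem : ∀ p ∈ M, ∀ h : 0 < p.lower, rotRD p h ∈ M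

/-- A category of partitions is group-theoretical if it contains the pair positioner
partition `▷`. -/
def IsGroupTheoreticalCategory (M : Set PartitionDiagram) : Prop :=
  IsPartitionCategory M ∧ pairPositioner ∈ M

/-- The smallest category of partitions containing a given set of partitions. -/
def generatedCategory (S : Set PartitionDiagram) : Set PartitionDiagram :=
  ⋂₀ { M | IsPartitionCategory M ∧ S ⊆ M }

/-- The group `Z_2^{*∞}`: the free product of countably many copies of the cyclic group of
order two. -/
abbrev FreeZ2 := Monoid.CoprodI (fun _ : ℕ => Multiplicative (ZMod 2))

/-- The free generators `a_1, a_2, …` of `Z_2^{*∞}`, each of order two. -/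
def gen (n : ℕ) : FreeZ2 :=
  Monoid.CoprodI.of (i := n) (Multiplicative.ofAdd (1 : ZMod 2))

/-- A labelling of a partition assigns (indices of) pairwise distinct generators of
`Z_2^{*∞}` to the blocks: two points receive the same label iff they lie in the same block. -/
def IsLabelling (p : PartitionDiagram) (lab : Fin p.upper ⊕ Fin p.lower → ℕ) : Prop :=
  ∀ x y, lab x = lab y ↔ p.rel.r x y

/-- The word `w(p,l) ∈ Z_2^{*∞}` of a labelled partition: after rotating all upper points to
the right-hand end of the lower row, read off the generators assigned to the points from left
to right, i.e. read the lower points from left to right and then the upper points from right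
to left. -/
def wordOf (p : PartitionDiagram) (lab : Fin p.upper ⊕ Fin p.lower → ℕ) : FreeZ2 :=
  ((List.ofFn fun j : Fin p.lower => gen (lab (Sum.inr j))) ++
    (List.ofFn fun i : Fin p.upper => gen (lab (Sum.inl i))).reverse).prod

/-- `F(C) ⊆ Z_2^{*∞}` is the set of all `w(p,l)` where `p ∈ C` and `l` is a labelling. -/
def Fmap (M : Set PartitionDiagram) : Set FreeZ2 :=
  { g | ∃ p ∈ M, ∃ lab, IsLabelling p lab ∧ wordOf p lab = g }

/-- The set of partitions admitting a labelling whose word lies in `H`. -/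
def catOf (H : Set FreeZ2) : Set PartitionDiagram :=
  { p | ∃ lab, IsLabelling p lab ∧ wordOf p lab ∈ H }

/-- The endomorphism of `Z_2^{*∞}` identifying letters according to `f`, i.e. sending
`a_k` to `a_{f k}` for every `k`. -/
def identifyLetters (f : ℕ → ℕ) : Monoid.End FreeZ2 :=
  Monoid.CoprodI.lift fun i =>
    (Monoid.CoprodI.of (M := fun _ : ℕ => Multiplicative (ZMod 2)) (i := f i))

/-- The strong symmetric semigroup `sS_∞`: the subsemigroup of `End(Z_2^{*∞})` generated by
the finite identifications of letters. -/
def strongSymmetricSemigroup : Subsemigroup (Monoid.End FreeZ2) :=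
  Subsemigroup.closure
    { φ | ∃ f : ℕ → ℕ, (∃ n : ℕ, ∀ k, n ≤ k → f k = k) ∧ φ = identifyLetters f }

/-- A subset of `Z_2^{*∞}` is `sS_∞`-invariant if it is preserved by every element of the
strong symmetric semigroup. -/
def IsSSInvariant (H : Set FreeZ2) : Prop :=
  ∀ φ ∈ strongSymmetricSemigroup, ∀ g ∈ H, φ g ∈ H

/-- A partition is in single leg form if it has no upper points and no two consecutive
points belong to the same block. -/
def IsSingleLeg (p : PartitionDiagram) : Prop :=
  p.upper = 0 ∧
    ∀ i j : Fin p.lower, (j : ℕ) = (i : ℕ) + 1 → ¬ p.rel.r (Sum.inr i) (Sum.inr j)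

/-- `C_sl`: the set of all partitions in `C` with no upper points in single leg form. -/
def slSet (M : Set PartitionDiagram) : Set PartitionDiagram :=
  { p ∈ M | IsSingleLeg p }

/-- The partition with no upper points determined by a word (a list of letters): two points
lie in the same block iff the corresponding letters coincide. -/
def wordPartition (w : List ℕ) : PartitionDiagram :=
  ofLabels (u := 0) (l := w.length) (Sum.elim (fun i => (i : ℕ)) fun j => w.get j)

/-- The canonical letter of the block of a lower point: the least index of a point in its
block. -/
noncomputable def blockLabel (p : PartitionDiagram) (j : Fin p.lower) : ℕ :=
  sInf { i : ℕ | ∃ h : i < p.lower, p.rel.r (Sum.inr ⟨i, h⟩) (Sum.inr j) }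

/-- The canonical word of a partition with no upper points. -/
noncomputable def canonWord (p : PartitionDiagram) : List ℕ :=
  List.ofFn fun j : Fin p.lower => blockLabel p j

/-- Full reduction of a word over an alphabet of involutions: repeatedly delete adjacent
equal pairs of letters.  This computes the result of iterating the operation replacing every
exponent in the run-decomposition of the word by its parity. -/
def reduceWord (w : List ℕ) : List ℕ :=
  w.foldr (fun x acc => match acc with
    | [] => [x]
    | y :: rest => if x = y then rest else x :: y :: rest) []

/-- The single leg version of a partition with no upper points: the unique partition in
single leg form obtained by iteratively replacing every exponent in its run-decomposition by
its parity. -/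
noncomputable def singleLegVersion (p : PartitionDiagram) : PartitionDiagram :=
  wordPartition (reduceWord (canonWord p))

namespace PartitionDiagram

/-- The label of a point of a diagram whose upper row is labelled by `c` and whose lower row is
labelled by `d`. -/
def rowLabel {u l : ℕ} (c d : List ℕ) : Fin u ⊕ Fin l → ℕ :=
  Sum.elim (fun i => c.getD i 0) fun j => d.getD j 0

/-- The diagram `p` is the one obtained by labelling the upper row with `c` and the lower row
with `d`. -/
def Represents (p : PartitionDiagram) (c d : List ℕ) : Prop :=
  p.upper = c.length ∧ p.lower = d.length ∧
    ∀ x y, p.rel.r x y ↔ (rowLabel c d x = rowLabel c d y)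

theorem Represents.unique {p q : PartitionDiagram} {c d : List ℕ}
    (hp : p.Represents c d) (hq : q.Represents c d) : p = q := by
  obtain ⟨pu, pl, pr⟩ := p
  obtain ⟨qu, ql, qr⟩ := q
  obtain ⟨h1, h2, h3⟩ := hp
  obtain ⟨k1, k2, k3⟩ := hq
  dsimp only at h1 h2 k1 k2
  subst h1 h2 k1 k2
  congr 1
  ext x y
  exact (h3 x y).trans (k3 x y).symm

theorem exists_represents (p : PartitionDiagram) : ∃ c d, p.Represents c d := by
  let f : Fin p.upper ⊕ Fin p.lower → ℕ := fun x =>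
    (Fintype.equivFin (Quotient p.rel) (Quotient.mk p.rel x) : ℕ)
  refine ⟨List.ofFn fun i => f (Sum.inl i), List.ofFn fun j => f (Sum.inr j),
    by simp, by simp, fun x y => ?_⟩
  have key : ∀ z, rowLabel (List.ofFn fun i => f (Sum.inl i))
      (List.ofFn fun j => f (Sum.inr j)) z = f z := by
    rintro (i | j)
    · simp [rowLabel]
    · simp [rowLabel]
  rw [key, key]
  simp only [f, Fin.val_inj, EmbeddingLike.apply_eq_iff_eq, Quotient.eq]

theorem Represents.comap {p : PartitionDiagram} {c d c' d' : List ℕ} (hp : p.Represents c d)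
    {u l : ℕ} (hu : u = c'.length) (hl : l = d'.length)
    (g : Fin u ⊕ Fin l → Fin p.upper ⊕ Fin p.lower)
    (hg : ∀ x, rowLabel c d (g x) = rowLabel c' d' x) :
    Represents ⟨u, l, Setoid.comap g p.rel⟩ c' d' := by
  refine ⟨hu, hl, fun x y => ?_⟩
  rw [← hg, ← hg]
  exact hp.2.2 _ _

theorem Represents.invol {p : PartitionDiagram} {c d : List ℕ} (hp : p.Represents c d) :
    p.invol.Represents d c :=
  hp.comap hp.2.1 hp.1 Sum.swap (by rintro (i | j) <;> rfl)

theorem Represents.rotLU {p : PartitionDiagram} {x : ℕ} {c d : List ℕ}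
    (hp : p.Represents (x :: c) d) (h : 0 < p.upper) : (p.rotLU h).Represents c (x :: d) := by
  have h1 := hp.1
  have h2 := hp.2.1
  simp only [List.length_cons] at h1
  refine hp.comap (by omega) (by simp; omega) _ ?_
  rintro (i | ⟨_ | j, hj⟩) <;> simp [rowLabel]

theorem Represents.rotLD {p : PartitionDiagram} {x : ℕ} {c d : List ℕ}
    (hp : p.Represents c (x :: d)) (h : 0 < p.lower) : (p.rotLD h).Represents (x :: c) d := by
  have h1 := hp.1
  have h2 := hp.2.1
  simp only [List.length_cons] at h2
  refine hp.comap (by simp; omega) (by omega) _ ?_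
  rintro (⟨_ | i, hi⟩ | j) <;> simp [rowLabel]

theorem Represents.rotRU {p : PartitionDiagram} {x : ℕ} {c d : List ℕ}
    (hp : p.Represents (c ++ [x]) d) (h : 0 < p.upper) :
    (p.rotRU h).Represents c (d ++ [x]) := by
  have h1 := hp.1
  have h2 := hp.2.1
  simp only [List.length_append, List.length_singleton] at h1
  refine hp.comap (by omega) (by simp; omega) _ ?_
  rintro (⟨i, hi⟩ | ⟨j, hj⟩)
  · simp only [rowLabel, Sum.elim_inl]
    rw [List.getD_append _ _ _ _ (by omega)]
  · by_cases hlt : j < p.lower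
    · simp only [hlt, dite_true, rowLabel, Sum.elim_inr]
      rw [List.getD_append _ _ _ _ (by omega)]
    · have : j = d.length := by omega
      have : p.upper - 1 = c.length := by omega
      simp [rowLabel, *]

theorem Represents.rotRD {p : PartitionDiagram} {x : ℕ} {c d : List ℕ}
    (hp : p.Represents c (d ++ [x])) (h : 0 < p.lower) :
    (p.rotRD h).Represents (c ++ [x]) d := by
  have h1 := hp.1
  have h2 := hp.2.1
  simp only [List.length_append, List.length_singleton] at h2
  refine hp.comap (by simp; omega) (by omega) _ ?_
  rintro (⟨i, hi⟩ | ⟨j, hj⟩)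
  · by_cases hlt : i < p.upper
    · simp only [hlt, dite_true, rowLabel, Sum.elim_inl]
      rw [List.getD_append _ _ _ _ (by omega)]
    · have : i = c.length := by omega
      have : p.lower - 1 = d.length := by omega
      simp [rowLabel, *]
  · simp only [rowLabel, Sum.elim_inr]
    rw [List.getD_append _ _ _ _ (by omega)]

theorem Represents.comp {p q : PartitionDiagram} {a b c : List ℕ} {f : ℕ → ℕ}
    (hp : p.Represents c (a.map f)) (hq : q.Represents a b) (h : p.lower = q.upper)
    (hf : ∀ j ∈ b, j ∈ a ∨ f j ∉ c ∧ ∀ i ∈ b, f i = f j → i = j) :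
    (comp p q h).Represents c (b.map f) := by
  obtain ⟨hpu, hpl, hpr⟩ := hp
  obtain ⟨hqu, hql, hqr⟩ := hq
  refine ⟨hpu, by simpa [PartitionDiagram.comp] using hql, ?_⟩
  change ∀ x y : Fin p.upper ⊕ Fin q.lower,
    Relation.EqvGen (compRel p q h) (Sum.map id Sum.inr x) (Sum.map id Sum.inr y) ↔
      rowLabel c (b.map f) x = rowLabel c (b.map f) y
  intro x y
  let L : Fin p.upper ⊕ (Fin p.lower ⊕ Fin q.lower) → ℕ :=
    Sum.elim (fun i => c.getD i 0) (rowLabel (a.map f) (b.map f))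
  have hmap : ∀ (s : List ℕ) (i : ℕ), i < s.length → (s.map f).getD i 0 = f (s.getD i 0) := by
    intro s i hi
    simp [List.getD_eq_getElem?_getD, hi]
  have hLp : ∀ z, L (iotaP p q z) = rowLabel c (a.map f) z := by
    rintro (i | j) <;> rfl
  have hLq : ∀ z, L (iotaQ p q h z) = f (rowLabel a b z) := by
    rintro (i | j)
    · exact hmap a i (by omega)
    · exact hmap b j (by omega)
  have hLx : ∀ z : Fin p.upper ⊕ Fin q.lower,
      L (Sum.map id Sum.inr z) = rowLabel c (b.map f) z := by
    rintro (i | j) <;> rfl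
  have fwd : ∀ s t, Relation.EqvGen (compRel p q h) s t → L s = L t := by
    intro s t hst
    induction hst with
    | rel s t hst =>
      rcases hst with ⟨m, n, hmn, rfl, rfl⟩ | ⟨m, n, hmn, rfl, rfl⟩
      · rw [hLp, hLp]; exact (hpr _ _).1 hmn
      · rw [hLq, hLq, (hqr _ _).1 hmn]
    | refl => rfl
    | symm _ _ _ ih => exact ih.symm
    | trans _ _ _ _ _ ih1 ih2 => exact ih1.trans ih2
  have hmem : ∀ (s : List ℕ) (i : ℕ), i < s.length → s.getD i 0 ∈ s := by
    intro s i hi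
    rw [List.getD_eq_getElem _ _ hi]
    exact List.getElem_mem _
  -- a point is either connected to a point of `p` or carries a fresh label
  have attach : ∀ z : Fin p.upper ⊕ Fin q.lower,
      (∃ w, Relation.EqvGen (compRel p q h) (Sum.map id Sum.inr z) (iotaP p q w)) ∨
      ∃ j : Fin q.lower, z = Sum.inr j ∧ f (b.getD j 0) ∉ c ∧
        ∀ i ∈ b, f i = f (b.getD j 0) → i = b.getD j 0 := by
    rintro (i | j)
    · exact Or.inl ⟨Sum.inl i, Relation.EqvGen.refl _⟩
    · rcases hf _ (hmem b j (by omega)) with hja | hfresh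
      · left
        obtain ⟨k, hk, hkj⟩ := List.getElem_of_mem hja
        have hk' : k < q.upper := by omega
        refine ⟨Sum.inr ⟨k, by omega⟩, Relation.EqvGen.rel _ _
          (Or.inr ⟨Sum.inr j, Sum.inl ⟨k, hk'⟩, (hqr _ _).2 ?_, rfl, rfl⟩)⟩
        simp only [rowLabel, Sum.elim_inr, Sum.elim_inl]
        rw [List.getD_eq_getElem _ _ hk, hkj]
      · exact Or.inr ⟨j, rfl, hfresh⟩
  have fresh : ∀ (j : Fin q.lower) (z : Fin p.upper ⊕ Fin q.lower), f (b.getD j 0) ∉ c →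
      (∀ i ∈ b, f i = f (b.getD j 0) → i = b.getD j 0) →
      rowLabel c (b.map f) z = rowLabel c (b.map f) (Sum.inr j : Fin p.upper ⊕ Fin q.lower) →
      Relation.EqvGen (compRel p q h) (Sum.map id Sum.inr z) (Sum.inr (Sum.inr j)) := by
    rintro j (i | k) h1 h2 h3
    · simp only [rowLabel, Sum.elim_inl, Sum.elim_inr] at h3
      rw [hmap b j (by omega)] at h3
      exact absurd (h3 ▸ hmem c i (by omega)) h1
    · simp only [rowLabel, Sum.elim_inr] at h3
      rw [hmap b j (by omega), hmap b k (by omega)] at h3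
      exact Relation.EqvGen.rel _ _ (Or.inr ⟨Sum.inr k, Sum.inr j,
        (hqr _ _).2 (h2 _ (hmem b k (by omega)) h3), rfl, rfl⟩)
  constructor
  · intro hxy
    rw [← hLx, ← hLx]
    exact fwd _ _ hxy
  · intro hxy
    rcases attach x with ⟨v, hv⟩ | ⟨j, rfl, h1, h2⟩
    · rcases attach y with ⟨w, hw⟩ | ⟨j, rfl, h1, h2⟩
      · refine hv.trans _ _ _ (.trans _ _ _ (.rel _ _ (Or.inl ⟨v, w, (hpr _ _).2 ?_, rfl, rfl⟩))
          (hw.symm _ _))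
        rw [← hLp, ← hLp, ← fwd _ _ hv, ← fwd _ _ hw, hLx, hLx, hxy]
      · exact fresh j x h1 h2 hxy
    · exact (fresh j y h1 h2 hxy.symm).symm _ _

theorem Represents.isSingleLeg {p : PartitionDiagram} {w : List ℕ} (hp : p.Represents [] w)
    (hw : w.IsChain (· ≠ ·)) : IsSingleLeg p := by
  refine ⟨hp.1, fun i j hij hr => ?_⟩
  have h2 := hp.2.1
  have h3 := (hp.2.2 _ _).1 hr
  have hi : (i : ℕ) < w.length := by omega
  have hj : (i : ℕ) + 1 < w.length := by omega
  simp only [rowLabel, Sum.elim_inr, hij] at h3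
  rw [List.getD_eq_getElem _ _ hi, List.getD_eq_getElem _ _ hj] at h3
  exact List.isChain_iff_getElem.1 hw i hj h3

end PartitionDiagram

/-- The set `M` contains the diagram with rows labelled by `c` and `d`. -/
def HasRows (M : Set PartitionDiagram) (c d : List ℕ) : Prop :=
  ∃ p ∈ M, p.Represents c d

theorem PartitionDiagram.Represents.mem_iff {M : Set PartitionDiagram} {p : PartitionDiagram}
    {c d : List ℕ} (hp : p.Represents c d) : p ∈ M ↔ HasRows M c d :=
  ⟨fun h => ⟨p, h, hp⟩, fun ⟨_, hq, hq'⟩ => hp.unique hq' ▸ hq⟩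

namespace IsPartitionCategory

variable {M : Set PartitionDiagram}

theorem hasRows_pair (hM : IsPartitionCategory M) : HasRows M [] [0, 0] := by
  refine ⟨_, hM.pair_mem, rfl, rfl, ?_⟩
  change ∀ x y : Fin 0 ⊕ Fin 2, (0 : ℕ) = 0 ↔ rowLabel [] [0, 0] x = rowLabel [] [0, 0] y
  decide

theorem hasRows_swap (hM : IsPartitionCategory M) {c d : List ℕ} (h : HasRows M c d) :
    HasRows M d c :=
  let ⟨_, hp, hr⟩ := h
  ⟨_, hM.invol_mem _ hp, hr.invol⟩

theorem hasRows_cons (hM : IsPartitionCategory M) {x : ℕ} {c d : List ℕ} :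
    HasRows M (x :: c) d ↔ HasRows M c (x :: d) := by
  constructor
  · rintro ⟨p, hp, hr⟩
    have h : 0 < p.upper := by simp [hr.1]
    exact ⟨_, hM.rotLU_mem p hp h, hr.rotLU h⟩
  · rintro ⟨p, hp, hr⟩
    have h : 0 < p.lower := by simp [hr.2.1]
    exact ⟨_, hM.rotLD_mem p hp h, hr.rotLD h⟩

theorem hasRows_concat (hM : IsPartitionCategory M) {x : ℕ} {c d : List ℕ} :
    HasRows M (c ++ [x]) d ↔ HasRows M c (d ++ [x]) := by
  constructor
  · rintro ⟨p, hp, hr⟩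
    have h : 0 < p.upper := by simp [hr.1]
    exact ⟨_, hM.rotRU_mem p hp h, hr.rotRU h⟩
  · rintro ⟨p, hp, hr⟩
    have h : 0 < p.lower := by simp [hr.2.1]
    exact ⟨_, hM.rotRD_mem p hp h, hr.rotRD h⟩

theorem hasRows_reverse_append (hM : IsPartitionCategory M) (u c d : List ℕ) :
    HasRows M (u.reverse ++ c) d ↔ HasRows M c (u ++ d) := by
  induction u generalizing c with
  | nil => simp
  | cons x u ih =>
    rw [List.reverse_cons, List.append_assoc, ih, List.singleton_append, hM.hasRows_cons,
      List.cons_append]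

theorem hasRows_append_reverse (hM : IsPartitionCategory M) (v c d : List ℕ) :
    HasRows M (c ++ v.reverse) d ↔ HasRows M c (d ++ v) := by
  induction v generalizing d with
  | nil => simp
  | cons x v ih =>
    rw [List.reverse_cons, ← List.append_assoc, hM.hasRows_concat, ih, List.append_assoc,
      List.singleton_append]

theorem hasRows_rotate (hM : IsPartitionCategory M) (u v d : List ℕ) :
    HasRows M (u.reverse ++ v.reverse) d ↔ HasRows M [] (u ++ d ++ v) := by
  rw [hM.hasRows_reverse_append, ← List.nil_append v.reverse, hM.hasRows_append_reverse]

/-- Applying an element of the category to a segment of a word. -/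
theorem hasRows_apply (hM : IsPartitionCategory M) {a b : List ℕ} (hab : HasRows M a b)
    (f : ℕ → ℕ) {u v : List ℕ} (h : HasRows M [] (u ++ a.map f ++ v))
    (hf : ∀ j ∈ b, j ∈ a ∨ f j ∉ u ++ v ∧ ∀ i ∈ b, f i = f j → i = j) :
    HasRows M [] (u ++ b.map f ++ v) := by
  rw [← hM.hasRows_rotate] at h ⊢
  obtain ⟨p, hp, hpr⟩ := h
  obtain ⟨q, hq, hqr⟩ := hab
  have hpq : p.lower = q.upper := by rw [hpr.2.1, hqr.1, List.length_map]
  exact ⟨_, hM.comp_mem p hp q hq hpq, hpr.comp hqr hpq (by simpa using hf)⟩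

theorem hasRows_delete_pair (hM : IsPartitionCategory M) {x : ℕ} {u v : List ℕ}
    (h : HasRows M [] (u ++ x :: x :: v)) : HasRows M [] (u ++ v) := by
  simpa using hM.hasRows_apply (hM.hasRows_swap hM.hasRows_pair) (fun _ => x) (u := u) (v := v)
    (by simpa using h) (by simp)

theorem hasRows_insert_fresh_pair (hM : IsPartitionCategory M) {x : ℕ} {u v : List ℕ}
    (hx : x ∉ u ++ v) (h : HasRows M [] (u ++ v)) : HasRows M [] (u ++ x :: x :: v) := by
  simpa using hM.hasRows_apply hM.hasRows_pair (fun _ => x) (u := u) (v := v)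
    (by simpa using h) (by simpa using hx)

end IsPartitionCategory

namespace IsGroupTheoreticalCategory

variable {M : Set PartitionDiagram}

theorem hasRows_pairPositioner (hM : IsGroupTheoreticalCategory M) :
    HasRows M [0, 0, 1] [1, 0, 0] := by
  refine ⟨_, hM.2, rfl, rfl, ?_⟩
  change ∀ x y : Fin 3 ⊕ Fin 3,
    (Sum.elim (fun i : Fin 3 => if (i : ℕ) = 2 then 1 else 0)
      (fun j : Fin 3 => if (j : ℕ) = 0 then 1 else 0) x : ℕ) =
    Sum.elim (fun i : Fin 3 => if (i : ℕ) = 2 then 1 else 0)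
      (fun j : Fin 3 => if (j : ℕ) = 0 then 1 else 0) y ↔
    rowLabel [0, 0, 1] [1, 0, 0] x = rowLabel [0, 0, 1] [1, 0, 0] y
  decide

theorem hasRows_pair_swap (hM : IsGroupTheoreticalCategory M) {x y : ℕ} {u v : List ℕ} :
    HasRows M [] (u ++ x :: x :: y :: v) ↔ HasRows M [] (u ++ y :: x :: x :: v) := by
  constructor <;> intro h
  · simpa using hM.1.hasRows_apply hM.hasRows_pairPositioner (fun i => if i = 0 then x else y)
      (u := u) (v := v) (by simpa using h) (by simp)
  · simpa using hM.1.hasRows_apply (hM.1.hasRows_swap hM.hasRows_pairPositioner)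
      (fun i => if i = 0 then x else y) (u := u) (v := v) (by simpa using h) (by simp)

theorem hasRows_pair_move (hM : IsGroupTheoreticalCategory M) {x : ℕ} (u t v : List ℕ) :
    HasRows M [] (u ++ x :: x :: (t ++ v)) ↔ HasRows M [] (u ++ t ++ x :: x :: v) := by
  induction t generalizing u with
  | nil => simp
  | cons y t ih =>
    rw [List.cons_append, hM.hasRows_pair_swap]
    simpa using ih (u ++ [y])

theorem hasRows_fourBlock (hM : IsGroupTheoreticalCategory M) :
    HasRows M [0] [0, 0, 0] := by
  rw [hM.1.hasRows_cons]
  have h := (hM.1.hasRows_append_reverse [1, 0, 0] [] [1, 0, 0]).1 hM.hasRows_pairPositioner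
  have h' := (hM.hasRows_pair_swap (u := [1]) (v := [0, 0]) (x := 0) (y := 1)).1 h
  exact hM.1.hasRows_delete_pair (u := []) h'

theorem hasRows_triple (hM : IsGroupTheoreticalCategory M) {x : ℕ} {u v : List ℕ}
    (h : HasRows M [] (u ++ x :: v)) : HasRows M [] (u ++ x :: x :: x :: v) := by
  simpa using hM.1.hasRows_apply hM.hasRows_fourBlock (fun _ => x) (u := u) (v := v)
    (by simpa using h) (by simp)

theorem hasRows_insert_pair (hM : IsGroupTheoreticalCategory M) {x : ℕ} {u v : List ℕ}
    (h : HasRows M [] (u ++ v)) : HasRows M [] (u ++ x :: x :: v) := by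
  by_cases hx : x ∈ u ++ v
  · rcases List.mem_append.1 hx with hx | hx
    · obtain ⟨s, t, rfl⟩ := List.append_of_mem hx
      have h' := hM.hasRows_triple (u := s) (v := t ++ v) (x := x) (by simpa using h)
      simpa using (hM.hasRows_pair_move (x := x) (s ++ [x]) t v).1 (by simpa using h')
    · obtain ⟨s, t, rfl⟩ := List.append_of_mem hx
      have h' := hM.hasRows_triple (u := u ++ s) (v := t) (x := x) (by simpa using h)
      exact (hM.hasRows_pair_move u s (x :: t)).2 h'
  · exact hM.1.hasRows_insert_fresh_pair hx h

theorem hasRows_pair_iff (hM : IsGroupTheoreticalCategory M) {x : ℕ} {u v : List ℕ} :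
    HasRows M [] (u ++ x :: x :: v) ↔ HasRows M [] (u ++ v) :=
  ⟨hM.1.hasRows_delete_pair, hM.hasRows_insert_pair⟩

end IsGroupTheoreticalCategory

theorem List.isChain_ne_or_exists_pair {α : Type*} (w : List α) :
    w.IsChain (· ≠ ·) ∨ ∃ u x v, w = u ++ x :: x :: v := by
  induction w with
  | nil => simp
  | cons a w ih =>
    rcases ih with h | ⟨u, x, v, rfl⟩
    · cases w with
      | nil => simp
      | cons b w =>
        by_cases hab : a = b
        · exact Or.inr ⟨[], a, w, by simp [hab]⟩
        · exact Or.inl (List.isChain_cons_cons.2 ⟨hab, h⟩)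
    · exact Or.inr ⟨a :: u, x, v, rfl⟩

theorem subset_of_slSet_subset {M N : Set PartitionDiagram}
    (hM : IsGroupTheoreticalCategory M) (hN : IsGroupTheoreticalCategory N)
    (h : slSet M ⊆ slSet N) : M ⊆ N := by
  have key : ∀ (n : ℕ) (w : List ℕ), w.length = n → HasRows M [] w → HasRows N [] w := by
    intro n
    induction n using Nat.strong_induction_on with
    | _ n ih =>
      rintro w rfl hw
      rcases w.isChain_ne_or_exists_pair with hc | ⟨u, x, v, rfl⟩
      · obtain ⟨p, hp, hr⟩ := hw
        exact ⟨p, (h ⟨hp, hr.isSingleLeg hc⟩).1, hr⟩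
      · rw [hM.hasRows_pair_iff] at hw
        rw [hN.hasRows_pair_iff]
        exact ih _ (by simp) _ rfl hw
  intro p hp
  obtain ⟨c, d, hr⟩ := p.exists_represents
  rw [hr.mem_iff, ← c.reverse_reverse, ← List.nil_append c.reverse.reverse] at hp ⊢
  rw [hM.1.hasRows_append_reverse] at hp
  rw [hN.1.hasRows_append_reverse]
  exact key _ _ rfl hp

/-- Let `C` and `D` be group-theoretical categories of partitions.  Then
`C_sl = D_sl` if and only if `C = D`. -/
theorem slSet_eq_iff_eq (M N : Set PartitionDiagram)
    (hM : IsGroupTheoreticalCategory M) (hN : IsGroupTheoreticalCategory N) :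
    slSet M = slSet N ↔ M = N := by
  refine ⟨fun h => ?_, fun h => h ▸ rfl⟩
  exact (subset_of_slSet_subset hM hN h.subset).antisymm (subset_of_slSet_subset hN hM h.superset)
end

section
/- Let C and D be group-theoretical categories of partitions. Then C_sl ⊆ D_sl if and only if C ⊆ D. -/
open Classical

open PartitionDiagram

namespace PartitionDiagram

/-- The label of a point when the upper points carry the letters of `u` and the lower points
those of `v`. -/
def pointLabel (u v : List ℕ) {a b : ℕ} : Fin a ⊕ Fin b → Option ℕ :=
  Sum.elim (fun i => u[(i : ℕ)]?) fun j => v[(j : ℕ)]?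

/-- The partition whose upper points are labelled by `u` and whose lower points are labelled
by `v`. -/
def ofWords (u v : List ℕ) : PartitionDiagram :=
  ⟨u.length, v.length, Setoid.ker (pointLabel u v)⟩

theorem eq_ofWords (p : PartitionDiagram) (u v : List ℕ) (hu : p.upper = u.length)
    (hv : p.lower = v.length)
    (h : ∀ x y, p.rel x y ↔ pointLabel u v x = pointLabel u v y) : p = ofWords u v := by
  obtain ⟨a, b, r⟩ := p
  dsimp only at hu hv
  subst hu hv
  have : r = Setoid.ker (pointLabel u v) := Setoid.ext fun x y => by
    rw [Setoid.ker_def]; exact h x y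
  rw [this, ofWords]

theorem exists_eq_ofWords (p : PartitionDiagram) : ∃ u v, p = ofWords u v := by
  obtain ⟨e, he⟩ := exists_injective_nat (Quotient p.rel)
  refine ⟨List.ofFn fun i : Fin p.upper => e (Quotient.mk p.rel (Sum.inl i)),
    List.ofFn fun j : Fin p.lower => e (Quotient.mk p.rel (Sum.inr j)),
    eq_ofWords _ _ _ (by simp) (by simp) ?_⟩
  rintro (x | x) (y | y) <;> simp [pointLabel, he.eq_iff, Quotient.eq]

/-- Recognising a pullback of `ofWords` along a map that preserves the labels of points. -/
theorem eq_ofWords_of_comap {u v u' v' : List ℕ} {a b : ℕ}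
    (f : Fin a ⊕ Fin b → Fin u.length ⊕ Fin v.length) (ha : a = u'.length)
    (hb : b = v'.length) (h : ∀ x, pointLabel u v (f x) = pointLabel u' v' x) :
    (⟨a, b, Setoid.comap f (ofWords u v).rel⟩ : PartitionDiagram) = ofWords u' v' := by
  refine eq_ofWords _ _ _ ha hb fun x y => ?_
  rw [← h x, ← h y]
  rfl

theorem rotRU_ofWords (u v : List ℕ) (x : ℕ) (h : 0 < (ofWords (u ++ [x]) v).upper) :
    rotRU (ofWords (u ++ [x]) v) h = ofWords u (v ++ [x]) := by
  refine eq_ofWords_of_comap _ (by simp [ofWords]) (by simp [ofWords]) ?_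
  rintro (⟨i, hi⟩ | ⟨i, hi⟩)
  · simp only [ofWords, List.length_append, List.length_singleton] at hi
    change (u ++ [x])[i]? = u[i]?
    rw [List.getElem?_append_left (by omega)]
  · simp only [ofWords] at hi
    by_cases hv : i < v.length
    · simp [pointLabel, List.getElem?_append, hv, ofWords]
    · simp [pointLabel, ofWords, show i = v.length by omega]

theorem rotRD_ofWords (u v : List ℕ) (x : ℕ) (h : 0 < (ofWords u (v ++ [x])).lower) :
    rotRD (ofWords u (v ++ [x])) h = ofWords (u ++ [x]) v := by
  refine eq_ofWords_of_comap _ (by simp [ofWords]) (by simp [ofWords]) ?_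
  rintro (⟨i, hi⟩ | ⟨i, hi⟩)
  · simp only [ofWords] at hi
    by_cases hv : i < u.length
    · simp [pointLabel, List.getElem?_append, hv, ofWords]
    · simp [pointLabel, ofWords, show i = u.length by omega]
  · simp only [ofWords, List.length_append, List.length_singleton] at hi
    change (v ++ [x])[i]? = v[i]?
    rw [List.getElem?_append_left (by omega)]

theorem rotLU_ofWords (u v : List ℕ) (x : ℕ) (h : 0 < (ofWords (x :: u) v).upper) :
    rotLU (ofWords (x :: u) v) h = ofWords u (x :: v) := by
  refine eq_ofWords_of_comap _ (by simp [ofWords]) (by simp [ofWords]) ?_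
  rintro (⟨i, hi⟩ | ⟨_ | i, hi⟩) <;> rfl

theorem rotLD_ofWords (u v : List ℕ) (x : ℕ) (h : 0 < (ofWords u (x :: v)).lower) :
    rotLD (ofWords u (x :: v)) h = ofWords (x :: u) v := by
  refine eq_ofWords_of_comap _ (by simp [ofWords]) (by simp [ofWords]) ?_
  rintro (⟨_ | i, hi⟩ | ⟨i, hi⟩) <;> rfl

/-- Composing along a shared middle row of letters: if every letter common to the outer rows
occurs in the middle row, the composition is the partition of the outer rows. -/
theorem comp_ofWords (u s v : List ℕ) (hs : ∀ x ∈ u, x ∈ v → x ∈ s) :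
    comp (ofWords u s) (ofWords s v) rfl = ofWords u v := by
  have left : ∀ a b : Fin u.length ⊕ Fin s.length, pointLabel u s a = pointLabel u s b →
      Relation.EqvGen (compRel (ofWords u s) (ofWords s v) rfl)
        (iotaP (ofWords u s) (ofWords s v) a) (iotaP (ofWords u s) (ofWords s v) b) :=
    fun a b hab => .rel _ _ (.inl ⟨a, b, hab, rfl, rfl⟩)
  have right : ∀ a b : Fin s.length ⊕ Fin v.length, pointLabel s v a = pointLabel s v b →
      Relation.EqvGen (compRel (ofWords u s) (ofWords s v) rfl)
        (iotaQ (ofWords u s) (ofWords s v) rfl a) (iotaQ (ofWords u s) (ofWords s v) rfl b) :=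
    fun a b hab => .rel _ _ (.inr ⟨a, b, hab, rfl, rfl⟩)
  have mixed : ∀ (i : Fin u.length) (j : Fin v.length), u[(i : ℕ)]? = v[(j : ℕ)]? →
      Relation.EqvGen (compRel (ofWords u s) (ofWords s v) rfl)
        (Sum.inl i) (Sum.inr (Sum.inr j)) := by
    intro i j hij
    have hu : u[(i : ℕ)]? = some u[i] := by simp
    have hv : v[(j : ℕ)]? = some v[j] := by simp
    have huv : u[i] = v[j] := Option.some.inj (hu.symm.trans (hij.trans hv))
    obtain ⟨k, hk, hks⟩ := List.getElem_of_mem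
      (hs u[i] (List.getElem_mem _) (huv.symm ▸ List.getElem_mem j.isLt))
    have hsk : s[k]? = some u[i] := by simp [hk, hks]
    exact .trans _ _ _ (left (.inl i) (.inr ⟨k, hk⟩) (hu.trans hsk.symm))
      (right (.inl ⟨k, hk⟩) (.inr j) (hsk.trans (hu.symm.trans hij)))
  have sound : ∀ a b, Relation.EqvGen (compRel (ofWords u s) (ofWords s v) rfl) a b →
      Sum.elim (fun i : Fin u.length => u[(i : ℕ)]?)
          (pointLabel (a := s.length) (b := v.length) s v) a =
        Sum.elim (fun i : Fin u.length => u[(i : ℕ)]?)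
          (pointLabel (a := s.length) (b := v.length) s v) b := by
    intro a b hab
    induction hab with
    | rel a b hab =>
      rcases hab with ⟨x, y, hxy, rfl, rfl⟩ | ⟨x, y, hxy, rfl, rfl⟩
      · have hxy : pointLabel u s x = pointLabel u s y := hxy
        rcases x with x | x <;> rcases y with y | y <;> exact hxy
      · have hxy : pointLabel s v x = pointLabel s v y := hxy
        rcases x with x | x <;> rcases y with y | y <;> exact hxy
    | refl => rfl
    | symm _ _ _ ih => exact ih.symm
    | trans _ _ _ _ _ ih₁ ih₂ => exact ih₁.trans ih₂
  refine eq_ofWords _ _ _ rfl rfl fun x y => ⟨fun hxy => ?_, fun hxy => ?_⟩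
  · have := sound _ _ hxy
    rcases x with x | x <;> rcases y with y | y <;> exact this
  · rcases x with x | x <;> rcases y with y | y
    · exact left (.inl x) (.inl y) hxy
    · exact mixed x y hxy
    · exact .symm _ _ (mixed y x hxy.symm)
    · exact right (.inr x) (.inr y) hxy

theorem ofLabels_eq_ofWords {a b : ℕ} (f : Fin a ⊕ Fin b → ℕ) (u v : List ℕ)
    (ha : a = u.length) (hb : b = v.length)
    (h : ∀ x y, f x = f y ↔ pointLabel u v x = pointLabel u v y) : ofLabels f = ofWords u v :=
  eq_ofWords _ _ _ ha hb h

theorem pairPartition_eq_ofWords (x : ℕ) : pairPartition = ofWords [] [x, x] := by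
  refine ofLabels_eq_ofWords _ _ _ rfl rfl fun a b => ?_
  rcases a with a | a <;> rcases b with b | b <;> fin_cases a <;> fin_cases b <;>
    simp [pointLabel]

theorem pairPositioner_eq_ofWords {x y : ℕ} (h : x ≠ y) :
    pairPositioner = ofWords [x, x, y] [y, x, x] := by
  refine ofLabels_eq_ofWords _ _ _ rfl rfl fun a b => ?_
  rcases a with a | a <;> rcases b with b | b <;> fin_cases a <;> fin_cases b <;>
    simp [pointLabel, h, h.symm]

end PartitionDiagram

namespace IsPartitionCategory

variable {M : Set PartitionDiagram}

theorem ofWords_mem_iff_lower_right (hM : IsPartitionCategory M) (u v : List ℕ) :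
    ofWords u v ∈ M ↔ ofWords [] (v ++ u.reverse) ∈ M := by
  induction u using List.reverseRecOn generalizing v with
  | nil => simp
  | append_singleton u x ih =>
    have step : ofWords (u ++ [x]) v ∈ M ↔ ofWords u (v ++ [x]) ∈ M := by
      refine ⟨fun h => ?_, fun h => ?_⟩
      · rw [← rotRU_ofWords u v x (by simp [ofWords])]
        exact hM.rotRU_mem _ h _
      · rw [← rotRD_ofWords u v x (by simp [ofWords])]
        exact hM.rotRD_mem _ h _
    rw [step, ih]
    simp

theorem ofWords_mem_iff_lower_left (hM : IsPartitionCategory M) (u v : List ℕ) :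
    ofWords u v ∈ M ↔ ofWords [] (u.reverse ++ v) ∈ M := by
  induction u generalizing v with
  | nil => simp
  | cons x u ih =>
    have step : ofWords (x :: u) v ∈ M ↔ ofWords u (x :: v) ∈ M := by
      refine ⟨fun h => ?_, fun h => ?_⟩
      · rw [← rotLU_ofWords u v x (by simp [ofWords])]
        exact hM.rotLU_mem _ h _
      · rw [← rotLD_ofWords u v x (by simp [ofWords])]
        exact hM.rotLD_mem _ h _
    rw [step, ih]
    simp

theorem word_rotate (hM : IsPartitionCategory M) {a b : List ℕ}
    (h : ofWords [] (a ++ b) ∈ M) : ofWords [] (b ++ a) ∈ M := by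
  have h' := (hM.ofWords_mem_iff_lower_left a.reverse b).2 (by simpa using h)
  simpa using (hM.ofWords_mem_iff_lower_right a.reverse b).1 h'

/-- Replacing the final segment `s` of a word by `v` along the partition `ofWords s v`. -/
theorem word_replace (hM : IsPartitionCategory M) {u s v : List ℕ}
    (h : ofWords [] (u ++ s) ∈ M) (hq : ofWords s v ∈ M)
    (hs : ∀ x ∈ u, x ∈ v → x ∈ s) : ofWords [] (u ++ v) ∈ M := by
  have hp := (hM.ofWords_mem_iff_lower_left u.reverse s).2 (by simpa using h)
  have hc := hM.comp_mem _ hp _ hq rfl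
  rw [comp_ofWords _ _ _ (by simpa using hs)] at hc
  simpa using (hM.ofWords_mem_iff_lower_left u.reverse v).1 hc

theorem pair_word_mem (hM : IsPartitionCategory M) (x : ℕ) : ofWords [] [x, x] ∈ M :=
  pairPartition_eq_ofWords x ▸ hM.pair_mem

theorem word_delete_pair (hM : IsPartitionCategory M) {u v : List ℕ} {x : ℕ}
    (h : ofWords [] (u ++ x :: x :: v) ∈ M) : ofWords [] (u ++ v) ∈ M := by
  have hq : ofWords [x, x] [] ∈ M :=
    (hM.ofWords_mem_iff_lower_left _ _).2 (hM.pair_word_mem x)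
  have h₁ : ofWords [] ((v ++ u) ++ [x, x]) ∈ M := by
    have := hM.word_rotate (a := u ++ [x, x]) (b := v) (by simpa using h)
    simpa using this
  exact hM.word_rotate (by simpa using hM.word_replace h₁ hq (by simp))

end IsPartitionCategory

namespace IsGroupTheoreticalCategory

variable {M : Set PartitionDiagram}

theorem word_move_pair_letter (hM : IsGroupTheoreticalCategory M) {a : List ℕ} {x y : ℕ}
    (h : ofWords [] (a ++ [x, x, y]) ∈ M) : ofWords [] (a ++ [y, x, x]) ∈ M := by
  rcases eq_or_ne x y with rfl | hxy
  · exact h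
  · refine hM.1.word_replace h (pairPositioner_eq_ofWords hxy ▸ hM.2) fun z _ hz => ?_
    simp only [List.mem_cons] at hz ⊢
    tauto

theorem word_move_pair (hM : IsGroupTheoreticalCategory M) {a b : List ℕ} {x : ℕ}
    (h : ofWords [] (a ++ x :: x :: b) ∈ M) : ofWords [] (a ++ b ++ [x, x]) ∈ M := by
  induction b generalizing a with
  | nil => simpa using h
  | cons y b ih =>
    have h₁ : ofWords [] ((b ++ a) ++ [x, x, y]) ∈ M := by
      have := hM.1.word_rotate (a := a ++ [x, x, y]) (b := b) (by simpa using h)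
      simpa using this
    have h₂ := hM.1.word_rotate (a := b) (b := a ++ [y, x, x])
      (by simpa using hM.word_move_pair_letter h₁)
    simpa using ih (a := a ++ [y]) (by simpa using h₂)

theorem four_word_mem (hM : IsGroupTheoreticalCategory M) (x : ℕ) :
    ofWords [] [x, x, x, x] ∈ M := by
  have h : ofWords [x, x, x + 1] [x + 1, x, x] ∈ M :=
    pairPositioner_eq_ofWords (Nat.ne_of_lt x.lt_succ_self) ▸ hM.2
  have h₁ := (hM.1.ofWords_mem_iff_lower_right _ _).1 h
  have h₂ := hM.word_move_pair (a := [x + 1]) (b := [x + 1, x, x]) (x := x) (by simpa using h₁)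
  exact hM.1.word_delete_pair (u := []) (x := x + 1) (by simpa using h₂)

theorem word_insert_pair (hM : IsGroupTheoreticalCategory M) {u v : List ℕ} (x : ℕ)
    (h : ofWords [] (u ++ v) ∈ M) : ofWords [] (u ++ x :: x :: v) ∈ M := by
  have append_pair : ∀ w, ofWords [] w ∈ M → ofWords [] (w ++ [x, x]) ∈ M := by
    intro w hw
    by_cases hx : x ∈ w
    · obtain ⟨a, b, rfl⟩ := List.append_of_mem hx
      have h₁ : ofWords [] ((b ++ a) ++ [x]) ∈ M := by
        have := hM.1.word_rotate (a := a ++ [x]) (b := b) (by simpa using hw)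
        simpa using this
      have hq : ofWords [x] [x, x, x] ∈ M :=
        (hM.1.ofWords_mem_iff_lower_left _ _).2 (hM.four_word_mem x)
      have h₂ := hM.1.word_replace h₁ hq (by simp)
      have h₃ := hM.1.word_rotate (a := b) (b := a ++ [x, x, x]) (by simpa using h₂)
      simpa using hM.word_move_pair (a := a ++ [x]) (b := b) (x := x) (by simpa using h₃)
    · refine hM.1.word_replace (s := []) (by simpa using hw) (hM.1.pair_word_mem x) ?_
      rintro z hz hzx
      simp only [List.mem_cons, List.not_mem_nil, or_false, or_self] at hzx
      exact absurd (hzx ▸ hz) hx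
  have h₁ := append_pair _ (hM.1.word_rotate h)
  have h₂ := hM.1.word_rotate (a := v) (b := u ++ [x, x]) (by simpa using h₁)
  simpa using h₂

end IsGroupTheoreticalCategory

theorem isSingleLeg_or_exists_pair (w : List ℕ) :
    IsSingleLeg (ofWords [] w) ∨ ∃ u x v, w = u ++ x :: x :: v := by
  by_cases hw : ∃ u x v, w = u ++ x :: x :: v
  · exact .inr hw
  · refine .inl ⟨rfl, fun i j hij hrel => hw ?_⟩
    have hi : (i : ℕ) + 1 < w.length := hij ▸ j.isLt
    have hrel : w[(i : ℕ)]? = w[(j : ℕ)]? := hrel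
    rw [hij, List.getElem?_eq_getElem (by omega), List.getElem?_eq_getElem hi] at hrel
    refine ⟨w.take i, w[(i : ℕ)], w.drop (i + 2), ?_⟩
    conv_lhs => rw [← List.take_append_drop i w]
    rw [List.drop_eq_getElem_cons (by omega), List.drop_eq_getElem_cons hi,
      ← Option.some.inj hrel]

/-- Let `C` and `D` be group-theoretical categories of partitions.  Then
`C_sl ⊆ D_sl` if and only if `C ⊆ D`. -/
theorem slSet_subset_iff_subset (M N : Set PartitionDiagram)
    (hM : IsGroupTheoreticalCategory M) (hN : IsGroupTheoreticalCategory N) :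
    slSet M ⊆ slSet N ↔ M ⊆ N := by
  refine ⟨fun h p hp => ?_, fun h p hp => ⟨h hp.1, hp.2⟩⟩
  have words : ∀ (n : ℕ) (w : List ℕ), w.length = n → ofWords [] w ∈ M → ofWords [] w ∈ N := by
    intro n
    induction n using Nat.strong_induction_on with
    | _ n ih =>
      intro w hn hw
      rcases isSingleLeg_or_exists_pair w with hsl | ⟨u, x, v, rfl⟩
      · exact (h ⟨hw, hsl⟩).1
      · exact hN.word_insert_pair x
          (ih _ (by simp at hn ⊢; omega) _ rfl (hM.1.word_delete_pair hw))
  obtain ⟨u, v, rfl⟩ := exists_eq_ofWords p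
  rw [hM.1.ofWords_mem_iff_lower_right] at hp
  rw [hN.1.ofWords_mem_iff_lower_right]
  exact words _ _ rfl hp
end
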